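/- Let f and g be probability mass functions on Z/pZ with decomposition g = g_△ + g_□ into △- and □-regular shape-equivalent parts. Then for every α ∈ [0, ∞], the Rényi entropy satisfies H_α(f ⋆ g) ≥ H_α(f^+ ⋆ g_△^- + f^- ⋆ g_□^+). -/

import Mathlib

open scoped BigOperators ENNReal Classical

namespace Paper

variable {p : ℕ}

/-- Convolution of two functions on `ZMod p`. -/
noncomputable def conv [NeZero p] (f g : ZMod p → ℝ) : ZMod p → ℝ :=
  fun k => ∑ i : ZMod p, f i * g (k - i)

/-- Iterated convolution of a list of functions (the delta mass at `0` is the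
convolution identity used as the base of the fold). -/
noncomputable def convList [NeZero p] (l : List (ZMod p → ℝ)) : ZMod p → ℝ :=
  l.foldr conv (fun k => if k = 0 then 1 else 0)

/-- The enumeration `0, +1, -1, +2, -2, ...` of `ZMod p`. -/
def plusSeq (p : ℕ) (n : ℕ) : ZMod p :=
  if n % 2 = 0 then -((n / 2 : ℕ) : ZMod p) else (((n + 1) / 2 : ℕ) : ZMod p)

/-- The enumeration `0, -1, +1, -2, +2, ...` of `ZMod p`. -/
def minusSeq (p : ℕ) (n : ℕ) : ZMod p := -(plusSeq p n)

/-- `fp` is the `+`-rearrangement of `f`: a permutation of the values of `f` that is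
nonincreasing along the ordering `0, +1, -1, +2, -2, ...`. -/
def IsPlusRearr (f fp : ZMod p → ℝ) : Prop :=
  (∃ σ : Equiv.Perm (ZMod p), fp = f ∘ σ) ∧
    ∀ n : ℕ, n + 1 < p → fp (plusSeq p (n + 1)) ≤ fp (plusSeq p n)

/-- `fm` is the `-`-rearrangement of `f`: a permutation of the values of `f` that is
nonincreasing along the ordering `0, -1, +1, -2, +2, ...`. -/
def IsMinusRearr (f fm : ZMod p → ℝ) : Prop :=
  (∃ σ : Equiv.Perm (ZMod p), fm = f ∘ σ) ∧
    ∀ n : ℕ, n + 1 < p → fm (minusSeq p (n + 1)) ≤ fm (minusSeq p n)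

/-- `f` is `△`-regular: its `+`-rearrangement is symmetric (so `f⁺ = f⁻`). -/
def TriangleRegular (f : ZMod p → ℝ) : Prop :=
  ∃ fp, IsPlusRearr f fp ∧ ∀ z, fp (-z) = fp z

/-- `f` is `□`-regular: `f⁺(z+1) = f⁻(z)` for all `z`. -/
def SquareRegular (f : ZMod p → ℝ) : Prop :=
  ∃ fp fm, IsPlusRearr f fp ∧ IsMinusRearr f fm ∧ ∀ z, fp (z + 1) = fm z

/-- probability mass function on `ZMod p`. -/
def IsPMF [NeZero p] (f : ZMod p → ℝ) : Prop :=
  (∀ i, 0 ≤ f i) ∧ ∑ i : ZMod p, f i = 1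

/-- Weak majorization: for every `r`, the sum of the `r` largest values of `f` is at most
the sum of the `r` largest values of `g` (expressed via subsets of each cardinality). -/
def WeakMaj [NeZero p] (f g : ZMod p → ℝ) : Prop :=
  ∀ s : Finset (ZMod p), ∃ t : Finset (ZMod p),
    t.card = s.card ∧ ∑ i ∈ s, f i ≤ ∑ i ∈ t, g i

/-- Majorization: weak majorization together with equality of total sums. -/
def Maj [NeZero p] (f g : ZMod p → ℝ) : Prop :=
  WeakMaj f g ∧ ∑ i : ZMod p, f i = ∑ i : ZMod p, g i

/-- `f` and `g` are shape-equivalent: there is a single ordering of the index set along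
which both are nonincreasing. -/
def ShapeEquiv [NeZero p] (f g : ZMod p → ℝ) : Prop :=
  ∃ e : Fin p ≃ ZMod p, (∀ m n : Fin p, m ≤ n → f (e n) ≤ f (e m)) ∧
    (∀ m n : Fin p, m ≤ n → g (e n) ≤ g (e m))

/-- Rényi entropy of order `α ∈ [0,∞]` of a pmf on `ZMod p`. -/
noncomputable def renyi [NeZero p] (α : ℝ≥0∞) (f : ZMod p → ℝ) : ℝ :=
  if α = 0 then Real.log ((Finset.univ.filter (fun i => f i ≠ 0)).card)
  else if α = 1 then ∑ i : ZMod p, Real.negMulLog (f i)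
  else if α = ⊤ then -Real.log (⨆ i : ZMod p, f i)
  else (1 - α.toReal)⁻¹ * Real.log (∑ i : ZMod p, f i ^ α.toReal)



section Pollard

/-- The number of ways to write `x` as a sum of an element of `A` and an element of `B`. -/
def repCount (A B : Finset (ZMod p)) (x : ZMod p) : ℕ := (A.filter fun y => x - y ∈ B).card

theorem repCount_comm (A B : Finset (ZMod p)) (x : ZMod p) :
    repCount A B x = repCount B A x := by
  unfold repCount
  refine Finset.card_bij (fun y _ => x - y) ?_ ?_ ?_
  · intro y hy
    simp only [Finset.mem_filter] at hy ⊢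
    exact ⟨hy.2, by simpa using hy.1⟩
  · intro y _ z _ h
    simpa using h
  · intro y hy
    simp only [Finset.mem_filter] at hy
    exact ⟨x - y, by simpa using ⟨hy.2, hy.1⟩, by simp⟩

theorem repCount_union_left {A A' : Finset (ZMod p)} (h : Disjoint A A') (B : Finset (ZMod p))
    (x : ZMod p) : repCount (A ∪ A') B x = repCount A B x + repCount A' B x := by
  unfold repCount
  rw [Finset.filter_union, Finset.card_union_of_disjoint]
  exact Finset.disjoint_filter_filter h

theorem repCount_union_right {B B' : Finset (ZMod p)} (h : Disjoint B B') (A : Finset (ZMod p))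
    (x : ZMod p) : repCount A (B ∪ B') x = repCount A B x + repCount A B' x := by
  rw [repCount_comm, repCount_union_left h, repCount_comm B, repCount_comm B']

theorem repCount_inter_union (A B : Finset (ZMod p)) (x : ZMod p) :
    repCount A B x = repCount (A ∪ B) (A ∩ B) x + repCount (A \ B) (B \ A) x := by
  have hI : Disjoint (A ∩ B) (B \ A) := by
    rw [Finset.disjoint_left]; intro y; simp; tauto
  have hA : Disjoint A (B \ A) := Finset.disjoint_sdiff
  have hA' : Disjoint (A ∩ B) (A \ B) := by
    rw [Finset.disjoint_left]; intro y; simp; tauto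
  have e1 : B = (A ∩ B) ∪ (B \ A) := by ext y; simp; tauto
  have e2 : A ∪ B = A ∪ (B \ A) := by simp
  have e3 : A = (A ∩ B) ∪ (A \ B) := by ext y; simp; tauto
  have h1 : repCount A B x = repCount A (A ∩ B) x + repCount A (B \ A) x := by
    rw [← repCount_union_right hI, ← e1]
  have h2 : repCount A (B \ A) x
      = repCount (A ∩ B) (B \ A) x + repCount (A \ B) (B \ A) x := by
    rw [← repCount_union_left hA', ← e3]
  have h3 : repCount (A ∪ B) (A ∩ B) x
      = repCount A (A ∩ B) x + repCount (B \ A) (A ∩ B) x := by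
    rw [e2, repCount_union_left hA]
  rw [h1, h2, h3, repCount_comm (B \ A)]
  ring

theorem repCount_le_right (A B : Finset (ZMod p)) (x : ZMod p) : repCount A B x ≤ B.card := by
  rw [repCount_comm]
  exact Finset.card_filter_le _ _

theorem repCount_map_add_right (A B : Finset (ZMod p)) (c x : ZMod p) :
    repCount A (B.map (Equiv.addRight c).toEmbedding) x = repCount A B (x - c) := by
  unfold repCount
  congr 1
  ext y
  simp only [Finset.mem_filter, Finset.mem_map_equiv, Equiv.addRight_symm, Equiv.coe_addRight]
  rw [show x - y + -c = x - c - y by ring]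

theorem sum_repCount_eq_sum_card [NeZero p] (A B S : Finset (ZMod p)) :
    ∑ x ∈ S, repCount A B x = ∑ y ∈ A, ∑ z ∈ B, if y + z ∈ S then 1 else 0 := by
  simp only [repCount, Finset.card_filter]
  rw [Finset.sum_comm]
  refine Finset.sum_congr rfl fun y _ => ?_
  rw [← Finset.card_filter, ← Finset.card_filter]
  refine Finset.card_bij (fun x _ => x - y) ?_ ?_ ?_
  · intro x hx
    simp only [Finset.mem_filter] at hx ⊢
    exact ⟨hx.2, by simpa using hx.1⟩
  · intro x _ z _ h
    simpa using h
  · intro z hz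
    simp only [Finset.mem_filter] at hz
    exact ⟨y + z, by simpa using ⟨hz.2, hz.1⟩, by simp⟩

theorem sum_univ_repCount [NeZero p] (A B : Finset (ZMod p)) :
    ∑ x, repCount A B x = A.card * B.card := by
  rw [sum_repCount_eq_sum_card]
  simp

theorem card_add_card_le_add_repCount [NeZero p] (A B : Finset (ZMod p)) (x : ZMod p) :
    A.card + B.card ≤ p + repCount A B x := by
  have h : (B.map (Equiv.subLeft x).toEmbedding).card = B.card := Finset.card_map _
  have h2 : repCount A B x = (A ∩ B.map (Equiv.subLeft x).toEmbedding).card := by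
    unfold repCount
    congr 1
    ext y
    simp only [Finset.mem_filter, Finset.mem_inter, Finset.mem_map_equiv, Equiv.subLeft_symm_apply]
    rw [show -y + x = x - y by ring]
  rw [h2, ← h, ← Finset.card_union_add_card_inter]
  have := Finset.card_le_univ (A ∪ B.map (Equiv.subLeft x).toEmbedding)
  rw [ZMod.card] at this
  omega

theorem exists_add_notMem [Fact p.Prime] {A : Finset (ZMod p)} (hne : A.Nonempty)
    (hA : A ≠ Finset.univ) {d : ZMod p} (hd : d ≠ 0) : ∃ x ∈ A, x + d ∉ A := by
  by_contra! h
  obtain ⟨x, hx⟩ := hne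
  have hn : ∀ n : ℕ, x + n * d ∈ A := by
    intro n
    induction n with
    | zero => simpa using hx
    | succ n ih =>
      have := h _ ih
      rwa [show x + n * d + d = x + ((n + 1 : ℕ) : ZMod p) * d by push_cast; ring] at this
  refine hA (Finset.eq_univ_of_forall fun y => ?_)
  have := hn ((y - x) / d).val
  rwa [ZMod.natCast_zmod_val, div_mul_cancel₀ _ hd, add_sub_cancel] at this

/-- **Pollard's theorem**, in the range where the sumset bound does not wrap around. -/
theorem mul_card_add_card_le_sum_min_repCount [Fact p.Prime] (A B : Finset (ZMod p)) (t : ℕ)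
    (hA : t ≤ A.card) (hB : t ≤ B.card) (hp : A.card + B.card ≤ p + t) :
    t * (A.card + B.card) ≤ ∑ x, min t (repCount A B x) + t * t := by
  induction hb : B.card using Nat.strong_induction_on generalizing A B t with
  | _ b ih =>
  subst hb
  rcases hB.eq_or_lt with hB | hB
  · have : ∑ x, min t (repCount A B x) = A.card * B.card := by
      rw [← sum_univ_repCount]
      exact Finset.sum_congr rfl fun x _ => min_eq_right (hB ▸ repCount_le_right A B x)
    rw [this, ← hB]
    linarith [mul_comm t A.card]
  rcases Nat.eq_zero_or_pos t with rfl | ht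
  · simp
  obtain ⟨b, hb, b', hb', hbb⟩ := Finset.one_lt_card.1 (show 1 < B.card by omega)
  have hAu : A ≠ Finset.univ := by
    rintro rfl
    rw [Finset.card_univ, ZMod.card] at hp
    omega
  obtain ⟨x, hx, hxd⟩ := exists_add_notMem (Finset.card_pos.1 (by omega)) hAu
    (sub_ne_zero.2 hbb.symm)
  set C := B.map (Equiv.addRight (x - b)).toEmbedding with hC
  have hCc : C.card = B.card := Finset.card_map _
  have hsum : ∑ y, min t (repCount A B y) = ∑ y, min t (repCount A C y) := by
    simp only [hC, repCount_map_add_right]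
    exact ((Equiv.subRight (x - b)).sum_comp fun y => min t (repCount A B y)).symm
  rw [hsum, ← hCc]
  have hxC : x ∈ A ∩ C := by
    simp only [hC, Finset.mem_inter, Finset.mem_map_equiv, Equiv.addRight_symm,
      Equiv.coe_addRight]
    exact ⟨hx, by simpa using hb⟩
  have hlt : (A ∩ C).card < B.card := by
    rw [← hCc]
    refine Finset.card_lt_card ⟨Finset.inter_subset_right, fun h => hxd ?_⟩
    have : x + (b' - b) ∈ C := by
      simp only [hC, Finset.mem_map_equiv, Equiv.addRight_symm, Equiv.coe_addRight]
      rw [show x + (b' - b) + -(x - b) = b' by ring]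
      exact hb'
    exact (Finset.mem_inter.1 (h this)).1
  have hpos : 0 < (A ∩ C).card := Finset.card_pos.2 ⟨x, hxC⟩
  have hUI := Finset.card_union_add_card_inter A C
  have hU : (A ∪ C).card ≤ p := by simpa [ZMod.card] using Finset.card_le_univ (A ∪ C)
  have hA' := Finset.card_sdiff_add_card_inter A C
  have hC' := Finset.card_sdiff_add_card_inter C A
  rw [Finset.inter_comm] at hC'
  rcases le_or_gt t (A ∩ C).card with hti | hti
  · have key := ih _ hlt (A ∪ C) (A ∩ C) t (by omega) hti (by omega) rfl
    rw [hUI] at key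
    refine key.trans (Nat.add_le_add_right (Finset.sum_le_sum fun y _ => ?_) _)
    rw [repCount_inter_union A C]
    omega
  · obtain ⟨u, rfl⟩ := Nat.exists_eq_add_of_lt hti
    have key := ih _ (by omega) (A \ C) (C \ A) (u + 1) (by omega) (by omega) (by omega) rfl
    have hle : (A ∪ C).card * (A ∩ C).card + ∑ y, min (u + 1) (repCount (A \ C) (C \ A) y)
        ≤ ∑ y, min ((A ∩ C).card + u + 1) (repCount A C y) := by
      rw [← sum_univ_repCount, ← Finset.sum_add_distrib]
      refine Finset.sum_le_sum fun y _ => ?_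
      have := repCount_le_right (A ∪ C) (A ∩ C) y
      rw [repCount_inter_union A C]
      omega
    have e1 : (A ∪ C).card = (A \ C).card + (C \ A).card + (A ∩ C).card := by omega
    rw [e1] at hle
    rw [← hA', ← hC']
    nlinarith

theorem sum_repCount_add_le [Fact p.Prime] (A B S : Finset (ZMod p)) (t : ℕ)
    (hA : t ≤ A.card) (hB : t ≤ B.card) (hp : A.card + B.card ≤ p + t) :
    ∑ x ∈ S, repCount A B x + t * (A.card + B.card)
      ≤ A.card * B.card + t * S.card + t * t := by
  have h1 := mul_card_add_card_le_sum_min_repCount A B t hA hB hp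
  have h2 : ∑ x ∈ S, repCount A B x + ∑ x, min t (repCount A B x)
      ≤ ∑ x, repCount A B x + t * S.card := by
    have e : ∑ x, min t (repCount A B x) = ∑ x ∈ S, min t (repCount A B x)
        + ∑ x ∈ Sᶜ, min t (repCount A B x) := (Finset.sum_add_sum_compl S _).symm
    have e' : ∑ x, repCount A B x = ∑ x ∈ S, repCount A B x
        + ∑ x ∈ Sᶜ, repCount A B x := (Finset.sum_add_sum_compl S _).symm
    have i1 : ∑ x ∈ S, min t (repCount A B x) ≤ t * S.card := by
      calc _ ≤ ∑ x ∈ S, t := Finset.sum_le_sum fun x _ => min_le_left _ _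
        _ = _ := by simp [mul_comm]
    have i2 : ∑ x ∈ Sᶜ, min t (repCount A B x) ≤ ∑ x ∈ Sᶜ, repCount A B x :=
      Finset.sum_le_sum fun x _ => min_le_right _ _
    omega
  rw [sum_univ_repCount] at h2
  omega

/-- The number of representations of the `n`-th element of the enumeration as a sum of two
centred intervals of `a` and `b` residues modulo `p`. -/
def intervalCount (p a b n : ℕ) : ℕ := max (a + b - p) (min (min a b) ((a + b - n) / 2))

theorem le_sum_intervalCount {a b : ℕ} (ha : a ≤ p) (hb : b ≤ p) (s : ℕ) :
    a * b + intervalCount p a b s * s + intervalCount p a b s * intervalCount p a b s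
      ≤ ∑ n ∈ Finset.range s, intervalCount p a b n + intervalCount p a b s * (a + b) := by
  induction s with
  | zero =>
    have h : intervalCount p a b 0 = a ∨ intervalCount p a b 0 = b := by
      unfold intervalCount; omega
    rcases h with h | h <;> rw [h] <;> simp <;> nlinarith
  | succ s ih =>
    rw [Finset.sum_range_succ]
    have h : intervalCount p a b (s + 1) = intervalCount p a b s ∨
        intervalCount p a b s = intervalCount p a b (s + 1) + 1 ∧
          a + b = s + 2 * intervalCount p a b s := by
      unfold intervalCount; omega
    generalize intervalCount p a b (s + 1) = u at *
    generalize intervalCount p a b s = v at *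
    rcases h with rfl | ⟨rfl, h⟩
    · nlinarith
    · rw [h] at ih ⊢
      nlinarith

theorem sum_repCount_le_sum_intervalCount [Fact p.Prime] (A B S : Finset (ZMod p)) :
    ∑ x ∈ S, repCount A B x
      ≤ ∑ n ∈ Finset.range S.card, intervalCount p A.card B.card n := by
  have hA : A.card ≤ p := by simpa [ZMod.card] using Finset.card_le_univ A
  have hB : B.card ≤ p := by simpa [ZMod.card] using Finset.card_le_univ B
  have h1 := le_sum_intervalCount hA hB S.card
  have h2 := sum_repCount_add_le A B S (intervalCount p A.card B.card S.card)
    (by unfold intervalCount; omega) (by unfold intervalCount; omega)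
    (by unfold intervalCount; omega)
  omega

end Pollard

section Intervals

theorem plusSeq_eq_intCast (n : ℕ) :
    plusSeq p n = ((if n % 2 = 0 then -((n / 2 : ℕ) : ℤ) else (((n + 1) / 2 : ℕ) : ℤ) : ℤ) :
      ZMod p) := by
  unfold plusSeq
  split_ifs
  · rw [Int.cast_neg, Int.cast_natCast]
  · rw [Int.cast_natCast]

theorem eq_of_intCast_zmod_eq {y z : ℤ} (h : ((y : ℤ) : ZMod p) = z) (h1 : y - z < p)
    (h2 : z - y < p) : y = z := by
  rw [ZMod.intCast_eq_intCast_iff_dvd_sub] at h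
  have := Int.eq_zero_of_abs_lt_dvd h (abs_lt.2 ⟨by omega, by omega⟩)
  omega

theorem plusSeq_injOn : Set.InjOn (plusSeq p) (Finset.range p) := by
  intro m hm n hn h
  simp only [Finset.coe_range, Set.mem_Iio] at hm hn
  rw [plusSeq_eq_intCast, plusSeq_eq_intCast] at h
  have := eq_of_intCast_zmod_eq h (by split_ifs <;> omega) (by split_ifs <;> omega)
  split_ifs at this <;> omega

theorem minusSeq_injOn : Set.InjOn (minusSeq p) (Finset.range p) :=
  fun _ hm _ hn h => plusSeq_injOn hm hn (neg_injective h)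

theorem intCast_mem_image_plusSeq {a : ℕ} {z : ℤ} (h1 : -(a : ℤ) < 2 * z) (h2 : 2 * z ≤ a) :
    (z : ZMod p) ∈ (Finset.range a).image (plusSeq p) := by
  rw [Finset.mem_image]
  rcases le_or_gt z 0 with hz | hz
  · refine ⟨2 * z.natAbs, Finset.mem_range.2 (by omega), ?_⟩
    rw [plusSeq_eq_intCast, if_pos (by omega)]
    congr 1
    omega
  · refine ⟨2 * z.natAbs - 1, Finset.mem_range.2 (by omega), ?_⟩
    rw [plusSeq_eq_intCast, if_neg (by omega)]
    congr 1
    omega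

theorem intCast_mem_image_minusSeq {a : ℕ} {z : ℤ} (h1 : -(a : ℤ) ≤ 2 * z) (h2 : 2 * z < a) :
    (z : ZMod p) ∈ (Finset.range a).image (minusSeq p) := by
  obtain ⟨n, hn, h⟩ := Finset.mem_image.1
    (intCast_mem_image_plusSeq (p := p) (z := -z) (a := a) (by omega) (by omega))
  refine Finset.mem_image.2 ⟨n, hn, ?_⟩
  simp [minusSeq, h]

theorem le_repCount_of_Ioc {A B : Finset (ZMod p)} {k L U : ℤ} {m : ℕ} (hm : m ≤ U - L)
    (hp : U - L ≤ p) (hA : ∀ y, L < y → y ≤ U → (y : ZMod p) ∈ A)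
    (hB : ∀ y, L < y → y ≤ U → ((k - y : ℤ) : ZMod p) ∈ B) : m ≤ repCount A B k := by
  have hc : ((Finset.Ioc L U).image (fun y : ℤ => (y : ZMod p))).card = (U - L).toNat := by
    rw [Finset.card_image_of_injOn, Int.card_Ioc]
    intro y hy z hz h
    simp only [Finset.coe_Ioc, Set.mem_Ioc] at hy hz
    exact eq_of_intCast_zmod_eq h (by omega) (by omega)
  calc m ≤ (U - L).toNat := by omega
    _ = _ := hc.symm
    _ ≤ _ := Finset.card_le_card fun x hx => by
      obtain ⟨y, hy, rfl⟩ := Finset.mem_image.1 hx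
      rw [Finset.mem_Ioc] at hy
      exact Finset.mem_filter.2 ⟨hA y hy.1 hy.2, by simpa using hB y hy.1 hy.2⟩

theorem intervalCount_le_repCount_of_odd [NeZero p] {a b : ℕ} (ha : a ≤ p) (hb : b ≤ p)
    (h : Odd b ∨ b = p) (n : ℕ) :
    intervalCount p a b n ≤ repCount ((Finset.range a).image (plusSeq p))
      ((Finset.range b).image (minusSeq p)) (plusSeq p n) := by
  have h1 := card_add_card_le_add_repCount ((Finset.range a).image (plusSeq p))
      ((Finset.range b).image (minusSeq p)) (plusSeq p n)
  rw [Finset.card_image_of_injOn (plusSeq_injOn.mono (by simpa using ha)),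
    Finset.card_image_of_injOn (minusSeq_injOn.mono (by simpa using hb)),
    Finset.card_range, Finset.card_range] at h1
  refine max_le (by omega) ?_
  rcases h with ⟨c, rfl⟩ | rfl
  · rcases Nat.eq_zero_or_pos (min (min a (2 * c + 1)) ((a + (2 * c + 1) - n) / 2)) with h0 | h0
    · omega
    rw [plusSeq_eq_intCast]
    set k : ℤ := if n % 2 = 0 then -((n / 2 : ℕ) : ℤ) else (((n + 1) / 2 : ℕ) : ℤ) with hk
    have hk' : n % 2 = 0 ∧ 2 * k = -n ∨ n % 2 = 1 ∧ 2 * k = n + 1 := by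
      rw [hk]; split_ifs <;> omega
    clear_value k
    refine le_repCount_of_Ioc (L := max (-(a : ℤ) / 2) (k - c - 1))
      (U := min ((a : ℤ) / 2) (k + c)) (by omega) (by omega) ?_ ?_
    · intro y h1 h2
      exact intCast_mem_image_plusSeq (by omega) (by omega)
    · intro y h1 h2
      exact intCast_mem_image_minusSeq (by omega) (by omega)
  · omega

theorem intervalCount_le_repCount_of_even [NeZero p] {a b : ℕ} (ha : a ≤ p) (hb : b ≤ p)
    (h : Even b ∨ b = p) (n : ℕ) :
    intervalCount p a b n ≤ repCount ((Finset.range a).image (minusSeq p))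
      ((Finset.range b).image (plusSeq p)) (plusSeq p n) := by
  have h1 := card_add_card_le_add_repCount ((Finset.range a).image (minusSeq p))
      ((Finset.range b).image (plusSeq p)) (plusSeq p n)
  rw [Finset.card_image_of_injOn (minusSeq_injOn.mono (by simpa using ha)),
    Finset.card_image_of_injOn (plusSeq_injOn.mono (by simpa using hb)),
    Finset.card_range, Finset.card_range] at h1
  refine max_le (by omega) ?_
  rcases h with ⟨c, rfl⟩ | rfl
  · rcases Nat.eq_zero_or_pos (min (min a (c + c)) ((a + (c + c) - n) / 2)) with h0 | h0
    · omega
    rw [plusSeq_eq_intCast]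
    set k : ℤ := if n % 2 = 0 then -((n / 2 : ℕ) : ℤ) else (((n + 1) / 2 : ℕ) : ℤ) with hk
    have hk' : n % 2 = 0 ∧ 2 * k = -n ∨ n % 2 = 1 ∧ 2 * k = n + 1 := by
      rw [hk]; split_ifs <;> omega
    clear_value k
    refine le_repCount_of_Ioc (L := max ((-(a : ℤ) - 1) / 2) (k - c - 1))
      (U := min (((a : ℤ) - 1) / 2) (k + c - 1)) (by omega) (by omega) ?_ ?_
    · intro y h1 h2
      exact intCast_mem_image_minusSeq (by omega) (by omega)
    · intro y h1 h2
      exact intCast_mem_image_plusSeq (by omega) (by omega)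
  · omega

end Intervals

section Rearrangement

/-- Summation by parts: a nonincreasing nonnegative weight preserves nonnegativity of partial
sums, and only the partial sums at the descents of the weight matter. -/
theorem sum_range_mul_nonneg {N : ℕ} {u c : ℕ → ℝ} (hu : ∀ n, n + 1 < N → u (n + 1) ≤ u n)
    (hpos : ∀ n < N, 0 ≤ u n)
    (hc : ∀ n < N, n + 1 = N ∨ u (n + 1) ≠ u n → 0 ≤ ∑ i ∈ Finset.range (n + 1), c i) :
    0 ≤ ∑ i ∈ Finset.range N, u i * c i := by
  have key : ∀ n < N, u n * ∑ i ∈ Finset.range (n + 1), c i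
      ≤ ∑ i ∈ Finset.range (n + 1), u i * c i := by
    intro n
    induction n with
    | zero => simp
    | succ n ih =>
      intro hn
      have h1 := ih (by omega)
      rw [Finset.sum_range_succ _ (n + 1), Finset.sum_range_succ _ (n + 1)]
      have h2 : 0 ≤ (u n - u (n + 1)) * ∑ i ∈ Finset.range (n + 1), c i := by
        by_cases h : u (n + 1) = u n
        · simp [h]
        · exact mul_nonneg (sub_nonneg.2 (hu n hn)) (hc n (by omega) (Or.inr h))
      linarith
  cases N with
  | zero => simp
  | succ N =>
    exact (mul_nonneg (hpos N (by omega)) (hc N (by omega) (Or.inl rfl))).trans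
      (key N (by omega))

theorem image_range_eq_univ [NeZero p] {e : ℕ → ZMod p} (he : Set.InjOn e (Finset.range p)) :
    (Finset.range p).image e = Finset.univ := by
  rw [← Finset.card_eq_iff_eq_univ, Finset.card_image_of_injOn he, Finset.card_range, ZMod.card]

theorem sum_univ_eq_sum_range [NeZero p] {e : ℕ → ZMod p} (he : Set.InjOn e (Finset.range p))
    (F : ZMod p → ℝ) : ∑ k, F k = ∑ i ∈ Finset.range p, F (e i) := by
  rw [← image_range_eq_univ he, Finset.sum_image he]

theorem sum_conv_eq_sum_range [NeZero p] {e e' : ℕ → ZMod p}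
    (he : Set.InjOn e (Finset.range p)) (he' : Set.InjOn e' (Finset.range p))
    (f g : ZMod p → ℝ) (S : Finset (ZMod p)) :
    ∑ k ∈ S, conv f g k = ∑ i ∈ Finset.range p, f (e i) *
      ∑ j ∈ Finset.range p, g (e' j) * if e i + e' j ∈ S then 1 else 0 := by
  unfold conv
  rw [Finset.sum_comm, sum_univ_eq_sum_range he]
  refine Finset.sum_congr rfl fun i _ => ?_
  rw [← Finset.mul_sum,
    ← sum_univ_eq_sum_range he' fun j => g j * if e i + j ∈ S then 1 else 0]
  congr 1
  rw [← (Equiv.subRight (e i)).sum_comp]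
  simp

theorem sum_repCount_image [NeZero p] {e e' : ℕ → ZMod p} (he : Set.InjOn e (Finset.range p))
    (he' : Set.InjOn e' (Finset.range p)) {a b : ℕ} (ha : a ≤ p) (hb : b ≤ p)
    (S : Finset (ZMod p)) :
    ((∑ x ∈ S, repCount ((Finset.range a).image e) ((Finset.range b).image e') x : ℕ) : ℝ)
      = ∑ i ∈ Finset.range a, ∑ j ∈ Finset.range b, if e i + e' j ∈ S then 1 else 0 := by
  rw [sum_repCount_eq_sum_card, Finset.sum_image (he.mono (by simpa using ha))]
  push_cast
  refine Finset.sum_congr rfl fun i _ => ?_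
  rw [Finset.sum_image (he'.mono (by simpa using hb))]

/-- A comparison of convolutions of functions that decrease along given enumerations follows from
the comparison for the superlevel sets. -/
theorem sum_conv_le_sum_conv [NeZero p] {e e' E E' : ℕ → ZMod p}
    (he : Set.InjOn e (Finset.range p)) (he' : Set.InjOn e' (Finset.range p))
    (hE : Set.InjOn E (Finset.range p)) (hE' : Set.InjOn E' (Finset.range p))
    {f g f' g' : ZMod p → ℝ} (hf : ∀ n, f' (E n) = f (e n)) (hg : ∀ n, g' (E' n) = g (e' n))
    (hf0 : ∀ k, 0 ≤ f' k) (hg0 : ∀ k, 0 ≤ g' k)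
    (hfE : ∀ n, n + 1 < p → f' (E (n + 1)) ≤ f' (E n))
    (hgE : ∀ n, n + 1 < p → g' (E' (n + 1)) ≤ g' (E' n)) {S S' : Finset (ZMod p)}
    (hS : ∀ a ≤ p, ∀ b < p, b + 1 = p ∨ g' (E' (b + 1)) ≠ g' (E' b) →
      ∑ x ∈ S, repCount ((Finset.range a).image e) ((Finset.range (b + 1)).image e') x
        ≤ ∑ x ∈ S', repCount ((Finset.range a).image E) ((Finset.range (b + 1)).image E') x) :
    ∑ k ∈ S, conv f g k ≤ ∑ k ∈ S', conv f' g' k := by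
  rw [sum_conv_eq_sum_range he he', sum_conv_eq_sum_range hE hE', ← sub_nonneg,
    ← Finset.sum_sub_distrib]
  simp only [← hf, ← hg, ← mul_sub, ← Finset.sum_sub_distrib]
  refine sum_range_mul_nonneg hfE (fun _ _ => hf0 _) fun a ha _ => ?_
  rw [Finset.sum_comm]
  simp only [← Finset.mul_sum]
  refine sum_range_mul_nonneg hgE (fun _ _ => hg0 _) fun b hb hb' => ?_
  rw [Finset.sum_comm]
  simp only [Finset.sum_sub_distrib]
  rw [← sum_repCount_image hE hE' ha hb, ← sum_repCount_image he he' ha hb, sub_nonneg,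
    Nat.cast_le]
  exact hS _ ha _ hb hb'

theorem le_of_step {N : ℕ} {u : ℕ → ℝ} (hu : ∀ n, n + 1 < N → u (n + 1) ≤ u n) {m n : ℕ}
    (hmn : m ≤ n) (hn : n < N) : u n ≤ u m := by
  induction n, hmn using Nat.le_induction with
  | base => rfl
  | succ n _ ih => exact (hu n hn).trans (ih (by omega))

/-- The bijection with `Fin p` given by an enumeration of `ZMod p`. -/
noncomputable def enumEquiv [NeZero p] (e : ℕ → ZMod p) (he : Set.InjOn e (Finset.range p)) :
    Fin p ≃ ZMod p :=
  Equiv.ofBijective (fun i => e i) <| by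
    rw [Fintype.bijective_iff_injective_and_card]
    refine ⟨fun i j h => Fin.ext (he ?_ ?_ h), by simp [ZMod.card]⟩ <;> simp

theorem enumEquiv_apply [NeZero p] (e : ℕ → ZMod p) (he : Set.InjOn e (Finset.range p))
    (i : Fin p) : enumEquiv e he i = e i := rfl

theorem rearr_unique [NeZero p] {e e' : ℕ → ZMod p} (he : Set.InjOn e (Finset.range p))
    (he' : Set.InjOn e' (Finset.range p)) {f h h' : ZMod p → ℝ}
    (hh : ∃ σ : Equiv.Perm (ZMod p), h = f ∘ σ) (hh' : ∃ σ : Equiv.Perm (ZMod p), h' = f ∘ σ)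
    (ha : ∀ n, n + 1 < p → h (e (n + 1)) ≤ h (e n))
    (ha' : ∀ n, n + 1 < p → h' (e' (n + 1)) ≤ h' (e' n)) {n : ℕ} (hn : n < p) :
    h (e n) = h' (e' n) := by
  obtain ⟨σ, rfl⟩ := hh
  obtain ⟨σ', rfl⟩ := hh'
  have := Tuple.unique_antitone (f := f ∘ enumEquiv e he)
    (σ := ((enumEquiv e he).trans σ).trans (enumEquiv e he).symm)
    (τ := ((enumEquiv e' he').trans σ').trans (enumEquiv e he).symm)
    (fun i j hij => by
      simpa [enumEquiv_apply] using le_of_step (u := fun n => (f ∘ σ) (e n)) ha hij j.2)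
    (fun i j hij => by
      simpa [enumEquiv_apply] using le_of_step (u := fun n => (f ∘ σ') (e' n)) ha' hij j.2)
  simpa [enumEquiv_apply] using congrFun this ⟨n, hn⟩

theorem exists_enum_antitone [NeZero p] (x : ZMod p → ℝ) :
    ∃ e : ℕ → ZMod p, Set.InjOn e (Finset.range p) ∧
      ∀ n, n + 1 < p → x (e (n + 1)) ≤ x (e n) := by
  let q := enumEquiv (plusSeq p) plusSeq_injOn
  let τ := Tuple.sort fun i => -x (q i)
  have hτ := Tuple.monotone_sort fun i => -x (q i)
  refine ⟨fun n => if h : n < p then q (τ ⟨n, h⟩) else 0, ?_, ?_⟩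
  · intro m hm n hn h
    simp only [Finset.coe_range, Set.mem_Iio] at hm hn
    simpa [hm, hn] using h
  · intro n hn
    have h : n < p := by omega
    simp only [hn, h, dif_pos]
    have := @hτ ⟨n, h⟩ ⟨n + 1, hn⟩ (by simp)
    simpa using this

theorem card_image_range {e : ℕ → ZMod p} (he : Set.InjOn e (Finset.range p)) {a : ℕ}
    (ha : a ≤ p) : ((Finset.range a).image e).card = a := by
  rw [Finset.card_image_of_injOn (he.mono (by simpa using ha)), Finset.card_range]

theorem sum_repCount_le_of_intervalCount_le [Fact p.Prime] {e e' E E' : ℕ → ZMod p}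
    (he : Set.InjOn e (Finset.range p)) (he' : Set.InjOn e' (Finset.range p)) {a b : ℕ}
    (ha : a ≤ p) (hb : b ≤ p) {S : Finset (ZMod p)}
    (h : ∀ n, intervalCount p a b n
      ≤ repCount ((Finset.range a).image E) ((Finset.range b).image E') (plusSeq p n)) :
    ∑ x ∈ S, repCount ((Finset.range a).image e) ((Finset.range b).image e') x
      ≤ ∑ x ∈ (Finset.range S.card).image (plusSeq p),
        repCount ((Finset.range a).image E) ((Finset.range b).image E') x := by
  have hS : S.card ≤ p := by simpa [ZMod.card] using Finset.card_le_univ S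
  refine (sum_repCount_le_sum_intervalCount _ _ S).trans ?_
  rw [card_image_range he ha, card_image_range he' hb,
    Finset.sum_image (plusSeq_injOn.mono (by simpa using hS))]
  exact Finset.sum_le_sum fun n _ => h n

theorem TriangleRegular.minusRearr_eq [NeZero p] {g gm : ZMod p → ℝ} (h : TriangleRegular g)
    (hgm : IsMinusRearr g gm) {n : ℕ} (hn : n + 1 < p) (ho : Odd n) :
    gm (minusSeq p (n + 1)) = gm (minusSeq p n) := by
  obtain ⟨fp, hfp, hs⟩ := h
  rw [rearr_unique minusSeq_injOn plusSeq_injOn hgm.1 hfp.1 hgm.2 hfp.2 hn,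
    rearr_unique minusSeq_injOn plusSeq_injOn hgm.1 hfp.1 hgm.2 hfp.2 (by omega : n < p)]
  rw [plusSeq, plusSeq, if_pos (by grind), if_neg (by grind), hs]

theorem SquareRegular.plusRearr_eq [NeZero p] {g gp : ZMod p → ℝ} (h : SquareRegular g)
    (hgp : IsPlusRearr g gp) {n : ℕ} (hn : n + 1 < p) (he : Even n) :
    gp (plusSeq p (n + 1)) = gp (plusSeq p n) := by
  obtain ⟨fp, fm, hfp, hfm, hs⟩ := h
  rw [rearr_unique plusSeq_injOn plusSeq_injOn hgp.1 hfp.1 hgp.2 hfp.2 hn,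
    rearr_unique plusSeq_injOn minusSeq_injOn hgp.1 hfm.1 hgp.2 hfm.2 (by omega : n < p), ← hs]
  rw [minusSeq, plusSeq, plusSeq, if_neg (by grind), if_pos (by grind), neg_neg,
    show (n + 1 + 1) / 2 = n / 2 + 1 by omega, Nat.cast_succ]

theorem sum_conv_le_of_triangleRegular [Fact p.Prime] {f fp g gm : ZMod p → ℝ}
    (hf : ∀ k, 0 ≤ f k) (hg : ∀ k, 0 ≤ g k) (hfp : IsPlusRearr f fp) (hgm : IsMinusRearr g gm)
    (hreg : TriangleRegular g) (S : Finset (ZMod p)) :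
    ∑ k ∈ S, conv f g k ≤ ∑ k ∈ (Finset.range S.card).image (plusSeq p), conv fp gm k := by
  obtain ⟨⟨σ, hσ⟩, hfp'⟩ := id hfp
  obtain ⟨⟨τ, hτ⟩, hgm'⟩ := id hgm
  have he : Set.InjOn (fun n => σ (plusSeq p n)) (Finset.range p) :=
    σ.injective.comp_injOn plusSeq_injOn
  have he' : Set.InjOn (fun n => τ (minusSeq p n)) (Finset.range p) :=
    τ.injective.comp_injOn minusSeq_injOn
  refine sum_conv_le_sum_conv he he' plusSeq_injOn minusSeq_injOn (fun n => congrFun hσ _)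
    (fun n => congrFun hτ _) (by simp [hσ, hf]) (by simp [hτ, hg]) hfp' hgm' ?_
  intro a ha b hb hb'
  refine sum_repCount_le_of_intervalCount_le he he' ha hb
    (intervalCount_le_repCount_of_odd ha hb ?_)
  by_contra! hcon
  refine hb'.elim (fun h => hcon.2 h) fun h => h (hreg.minusRearr_eq hgm (by omega) ?_)
  grind

theorem sum_conv_le_of_squareRegular [Fact p.Prime] {f fm g gp : ZMod p → ℝ}
    (hf : ∀ k, 0 ≤ f k) (hg : ∀ k, 0 ≤ g k) (hfm : IsMinusRearr f fm) (hgp : IsPlusRearr g gp)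
    (hreg : SquareRegular g) (S : Finset (ZMod p)) :
    ∑ k ∈ S, conv f g k ≤ ∑ k ∈ (Finset.range S.card).image (plusSeq p), conv fm gp k := by
  obtain ⟨⟨σ, hσ⟩, hfm'⟩ := id hfm
  obtain ⟨⟨τ, hτ⟩, hgp'⟩ := id hgp
  have he : Set.InjOn (fun n => σ (minusSeq p n)) (Finset.range p) :=
    σ.injective.comp_injOn minusSeq_injOn
  have he' : Set.InjOn (fun n => τ (plusSeq p n)) (Finset.range p) :=
    τ.injective.comp_injOn plusSeq_injOn
  refine sum_conv_le_sum_conv he he' minusSeq_injOn plusSeq_injOn (fun n => congrFun hσ _)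
    (fun n => congrFun hτ _) (by simp [hσ, hf]) (by simp [hτ, hg]) hfm' hgp' ?_
  intro a ha b hb hb'
  refine sum_repCount_le_of_intervalCount_le he he' ha hb
    (intervalCount_le_repCount_of_even ha hb ?_)
  by_contra! hcon
  refine hb'.elim (fun h => hcon.2 h) fun h => h (hreg.plusRearr_eq hgp (by omega) ?_)
  grind

end Rearrangement

section SchurConcavity

/-- A Karamata-type inequality; the tangent slope `c` of `φ` is only needed on `(0, ∞)`. -/
theorem sum_range_le_sum_range_of_prefix_le {φ c : ℝ → ℝ}
    (hφ : ∀ x y, 0 < x → 0 ≤ y → φ x + c x * (y - x) ≤ φ y)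
    (hc : ∀ x y, 0 < x → x ≤ y → c x ≤ c y) {N : ℕ} {x y : ℕ → ℝ}
    (hx : ∀ n < N, 0 ≤ x n) (hy : ∀ n < N, 0 ≤ y n) (hanti : ∀ n, n + 1 < N → x (n + 1) ≤ x n)
    (hle : ∀ s ≤ N, ∑ i ∈ Finset.range s, x i ≤ ∑ i ∈ Finset.range s, y i)
    (heq : ∑ i ∈ Finset.range N, x i = ∑ i ∈ Finset.range N, y i) :
    ∑ i ∈ Finset.range N, φ (x i) ≤ ∑ i ∈ Finset.range N, φ (y i) := by
  induction N with
  | zero => simp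
  | succ N ih =>
    rcases (hx N (by omega)).eq_or_lt with h0 | h0
    · have h1 := hle N (by omega)
      have h2 := hy N (by omega)
      rw [Finset.sum_range_succ, Finset.sum_range_succ, ← h0] at heq
      have hyN : y N = 0 := by linarith
      rw [Finset.sum_range_succ, Finset.sum_range_succ, ← h0, hyN]
      refine add_le_add_left (ih (fun n hn => hx n (by omega)) (fun n hn => hy n (by omega))
        (fun n hn => hanti n (by omega)) (fun s hs => hle s (by omega)) (by linarith)) _
    · have hpos : ∀ n < N + 1, 0 < x n := fun n hn =>
        h0.trans_le (le_of_step hanti (by omega) (by omega))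
      have key : 0 ≤ ∑ i ∈ Finset.range (N + 1), (c (x i) - c (x N)) * (y i - x i) := by
        refine sum_range_mul_nonneg
          (fun n hn => sub_le_sub_right (hc _ _ (hpos _ hn) (hanti n hn)) _)
          (fun n hn => sub_nonneg.2 (hc _ _ h0 (le_of_step hanti (by omega) (by omega))))
          fun n hn _ => ?_
        rw [Finset.sum_sub_distrib, sub_nonneg]
        exact hle _ (by omega)
      have hz : ∑ i ∈ Finset.range (N + 1), c (x N) * (y i - x i) = 0 := by
        rw [← Finset.mul_sum, Finset.sum_sub_distrib, heq, sub_self, mul_zero]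
      have ht : ∑ i ∈ Finset.range (N + 1), (φ (x i) + c (x i) * (y i - x i))
          ≤ ∑ i ∈ Finset.range (N + 1), φ (y i) :=
        Finset.sum_le_sum fun i hi =>
          hφ _ _ (hpos i (Finset.mem_range.1 hi)) (hy i (Finset.mem_range.1 hi))
      simp only [sub_mul, Finset.sum_sub_distrib] at key
      rw [Finset.sum_add_distrib] at ht
      linarith

theorem sum_le_sum_of_prefix_le [NeZero p] {φ c : ℝ → ℝ}
    (hφ : ∀ x y, 0 < x → 0 ≤ y → φ x + c x * (y - x) ≤ φ y)
    (hc : ∀ x y, 0 < x → x ≤ y → c x ≤ c y) {x y : ZMod p → ℝ} (hx : IsPMF x) (hy : IsPMF y)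
    {e : ℕ → ZMod p} (he : Set.InjOn e (Finset.range p))
    (h : ∀ S : Finset (ZMod p), ∑ k ∈ S, x k ≤ ∑ n ∈ Finset.range S.card, y (e n)) :
    ∑ k, φ (x k) ≤ ∑ k, φ (y k) := by
  obtain ⟨d, hd, hanti⟩ := exists_enum_antitone x
  rw [sum_univ_eq_sum_range hd, sum_univ_eq_sum_range he]
  refine sum_range_le_sum_range_of_prefix_le (x := fun n => x (d n)) (y := fun n => y (e n)) hφ hc
    (fun _ _ => hx.1 _) (fun _ _ => hy.1 _) hanti (fun s hs => ?_) ?_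
  · have := h ((Finset.range s).image d)
    rwa [card_image_range hd hs, Finset.sum_image (hd.mono (by simpa using hs))] at this
  · rw [← sum_univ_eq_sum_range hd, ← sum_univ_eq_sum_range he, hx.2, hy.2]

theorem rpow_tangent_le {a x y : ℝ} (ha : 1 ≤ a) (hx : 0 < x) (hy : 0 ≤ y) :
    x ^ a + a * x ^ (a - 1) * (y - x) ≤ y ^ a := by
  have h := one_add_mul_self_le_rpow_one_add (s := y / x - 1)
    (by linarith [div_nonneg hy hx.le]) ha
  rw [add_sub_cancel, Real.div_rpow hy hx.le, le_div_iff₀ (Real.rpow_pos_of_pos hx a)] at h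
  refine le_trans (le_of_eq ?_) h
  rw [Real.rpow_sub_one hx.ne']
  field_simp

theorem rpow_le_tangent {a x y : ℝ} (ha : 0 ≤ a) (ha' : a ≤ 1) (hx : 0 < x) (hy : 0 ≤ y) :
    y ^ a ≤ x ^ a + a * x ^ (a - 1) * (y - x) := by
  have h := rpow_one_add_le_one_add_mul_self (s := y / x - 1)
    (by linarith [div_nonneg hy hx.le]) ha ha'
  rw [add_sub_cancel, Real.div_rpow hy hx.le, div_le_iff₀ (Real.rpow_pos_of_pos hx a)] at h
  refine h.trans (le_of_eq ?_)
  rw [Real.rpow_sub_one hx.ne']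
  field_simp

theorem negMulLog_le_tangent {x y : ℝ} (hx : 0 < x) (hy : 0 ≤ y) :
    Real.negMulLog y ≤ Real.negMulLog x - (Real.log x + 1) * (y - x) := by
  rcases hy.eq_or_lt with rfl | hy
  · simp [Real.negMulLog]; nlinarith
  have h := Real.log_le_sub_one_of_pos (div_pos hx hy)
  rw [Real.log_div hx.ne' hy.ne'] at h
  have := mul_le_mul_of_nonneg_left h hy.le
  rw [mul_sub, mul_sub, mul_div_cancel₀ _ hy.ne'] at this
  unfold Real.negMulLog
  linarith

theorem IsPMF.exists_pos [NeZero p] {x : ZMod p → ℝ} (hx : IsPMF x) : ∃ k, 0 < x k := by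
  obtain ⟨k, -, hk⟩ := Finset.exists_ne_zero_of_sum_ne_zero (hx.2 ▸ one_ne_zero)
  exact ⟨k, (hx.1 k).lt_of_ne' hk⟩

theorem IsPMF.sum_rpow_pos [NeZero p] {x : ZMod p → ℝ} (hx : IsPMF x) (a : ℝ) :
    0 < ∑ k, x k ^ a := by
  obtain ⟨k, hk⟩ := hx.exists_pos
  exact Finset.sum_pos' (fun i _ => Real.rpow_nonneg (hx.1 i) a)
    ⟨k, Finset.mem_univ k, Real.rpow_pos_of_pos hk a⟩

/-- Rényi entropies decrease under majorization. -/
theorem renyi_le_of_prefix_le [NeZero p] (α : ℝ≥0∞) {x y : ZMod p → ℝ} (hx : IsPMF x)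
    (hy : IsPMF y) {e : ℕ → ZMod p} (he : Set.InjOn e (Finset.range p))
    (h : ∀ S : Finset (ZMod p), ∑ k ∈ S, x k ≤ ∑ n ∈ Finset.range S.card, y (e n)) :
    renyi α y ≤ renyi α x := by
  unfold renyi
  split_ifs with h0 h1 ht
  · obtain ⟨k, hk⟩ := hy.exists_pos
    have key := sum_le_sum_of_prefix_le (φ := fun t => -if t ≠ 0 then 1 else 0) (c := fun _ => 0)
      (fun u v hu _ => by
        simp only [zero_mul, add_zero]
        split_ifs <;> simp_all)
      (fun _ _ _ _ => le_rfl) hx hy he h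
    simp only [Finset.sum_neg_distrib, Finset.sum_boole, neg_le_neg_iff] at key
    exact Real.log_le_log
      (by exact_mod_cast Finset.card_pos.2 ⟨k, by simp [hk.ne']⟩) key
  · have key := sum_le_sum_of_prefix_le (φ := fun t => -Real.negMulLog t)
      (c := fun t => Real.log t + 1)
      (fun u v hu hv => by linarith [negMulLog_le_tangent hu hv])
      (fun u v hu huv => by linarith [Real.log_le_log hu huv]) hx hy he h
    simpa using key
  · obtain ⟨k, hk⟩ := hx.exists_pos
    have hbx : BddAbove (Set.range x) := (Set.finite_range x).bddAbove
    have hby : BddAbove (Set.range y) := (Set.finite_range y).bddAbove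
    refine neg_le_neg (Real.log_le_log (hk.trans_le (le_ciSup hbx k)) (ciSup_le fun i => ?_))
    have := h {i}
    simp only [Finset.sum_singleton, Finset.card_singleton, Finset.sum_range_one] at this
    exact this.trans (le_ciSup hby _)
  · have hα0 : 0 < α.toReal := ENNReal.toReal_pos h0 ht
    have hα1 : α.toReal ≠ 1 := fun h => h1 ((ENNReal.toReal_eq_one_iff α).1 h)
    rcases lt_or_gt_of_ne hα1 with hlt | hgt
    · have key := sum_le_sum_of_prefix_le (φ := fun t => -t ^ α.toReal)
        (c := fun t => -(α.toReal * t ^ (α.toReal - 1)))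
        (fun u v hu hv => by linarith [rpow_le_tangent hα0.le hlt.le hu hv])
        (fun u v hu huv => neg_le_neg (mul_le_mul_of_nonneg_left
          (Real.rpow_le_rpow_of_nonpos hu huv (by linarith)) hα0.le)) hx hy he h
      simp only [Finset.sum_neg_distrib, neg_le_neg_iff] at key
      exact mul_le_mul_of_nonneg_left (Real.log_le_log (hy.sum_rpow_pos _) key)
        (inv_nonneg.2 (by linarith))
    · have key := sum_le_sum_of_prefix_le (φ := fun t => t ^ α.toReal)
        (c := fun t => α.toReal * t ^ (α.toReal - 1))
        (fun u v hu hv => rpow_tangent_le hgt.le hu hv)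
        (fun u v hu huv => mul_le_mul_of_nonneg_left
          (Real.rpow_le_rpow hu.le huv (by linarith)) hα0.le) hx hy he h
      exact mul_le_mul_of_nonpos_left (Real.log_le_log (hx.sum_rpow_pos _) key)
        (inv_nonpos.2 (by linarith))

end SchurConcavity

theorem conv_nonneg [NeZero p] {f g : ZMod p → ℝ} (hf : ∀ k, 0 ≤ f k) (hg : ∀ k, 0 ≤ g k)
    (k : ZMod p) : 0 ≤ conv f g k :=
  Finset.sum_nonneg fun _ _ => mul_nonneg (hf _) (hg _)

theorem conv_add [NeZero p] (f g h : ZMod p → ℝ) : conv f (g + h) = conv f g + conv f h := by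
  ext k
  simp [conv, mul_add, Finset.sum_add_distrib]

theorem sum_conv [NeZero p] (f g : ZMod p → ℝ) : ∑ k, conv f g k = (∑ k, f k) * ∑ k, g k := by
  unfold conv
  rw [Finset.sum_comm, Finset.sum_mul]
  refine Finset.sum_congr rfl fun i _ => ?_
  rw [← Finset.mul_sum, ← (Equiv.subRight i).sum_comp g]
  simp

/-- For pmfs `f, g` on `ZMod p` with `g = g_△ + g_□` the shape-equivalent decomposition
into `△`- and `□`-regular parts, and every Rényi order `α ∈ [0,∞]`,
`H_α(f ⋆ g) ≥ H_α(f⁺ ⋆ g_△⁻ + f⁻ ⋆ g_□⁺)`. -/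
theorem renyi_conv_ge (hp : p.Prime) [NeZero p] (α : ℝ≥0∞)
    (f g gt gs : ZMod p → ℝ) (hf : IsPMF f) (hg : IsPMF g)
    (hdec : g = gt + gs) (hgt : TriangleRegular gt) (hgs : SquareRegular gs)
    (hgtnn : ∀ i, 0 ≤ gt i) (hgsnn : ∀ i, 0 ≤ gs i)
    (hshape1 : ShapeEquiv g gt) (hshape2 : ShapeEquiv g gs)
    (fp fm : ZMod p → ℝ) (hfp : IsPlusRearr f fp) (hfm : IsMinusRearr f fm)
    (gtm : ZMod p → ℝ) (hgtm : IsMinusRearr gt gtm)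
    (gsp : ZMod p → ℝ) (hgsp : IsPlusRearr gs gsp) :
    renyi α (conv f g) ≥ renyi α (conv fp gtm + conv fm gsp) := by
  have := Fact.mk hp
  rw [hdec, conv_add]
  have hgsum : ∑ k, gt k + ∑ k, gs k = 1 := by
    rw [← hg.2, hdec, ← Finset.sum_add_distrib]
    rfl
  obtain ⟨⟨σ₁, h₁⟩, -⟩ := id hfp
  obtain ⟨⟨σ₂, h₂⟩, -⟩ := id hfm
  obtain ⟨⟨σ₃, h₃⟩, -⟩ := id hgtm
  obtain ⟨⟨σ₄, h₄⟩, -⟩ := id hgsp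
  refine renyi_le_of_prefix_le α ⟨fun k => ?_, ?_⟩ ⟨fun k => ?_, ?_⟩ plusSeq_injOn fun S => ?_
  · exact add_nonneg (conv_nonneg hf.1 hgtnn k) (conv_nonneg hf.1 hgsnn k)
  · simp only [Pi.add_apply, Finset.sum_add_distrib, sum_conv]
    rw [hf.2, one_mul, one_mul, hgsum]
  · exact add_nonneg (conv_nonneg (by simp [h₁, hf.1]) (by simp [h₃, hgtnn]) k)
      (conv_nonneg (by simp [h₂, hf.1]) (by simp [h₄, hgsnn]) k)
  · simp only [Pi.add_apply, Finset.sum_add_distrib, sum_conv, h₁, h₂, h₃, h₄,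
      Function.comp_apply, Equiv.sum_comp]
    rw [hf.2, one_mul, one_mul, hgsum]
  · have hS : S.card ≤ p := by simpa [ZMod.card] using Finset.card_le_univ S
    rw [← Finset.sum_image (f := conv fp gtm + conv fm gsp)
      (plusSeq_injOn.mono (by simpa using hS))]
    simp only [Pi.add_apply, Finset.sum_add_distrib]
    exact add_le_add (sum_conv_le_of_triangleRegular hf.1 hgtnn hfp hgtm hgt S)
      (sum_conv_le_of_squareRegular hf.1 hgsnn hfm hgsp hgs S)

end Paper
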